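/- For every x ∈ 𝒟 one has the coordinatewise inequality ‖x − 𝒯(x)‖ ⪯ γ(E_f(x))·‖W_f(x)‖, where γ(t) = 1 + a t and a = (n−1)^{1/q}. (Lemma 4.2) -/

import Mathlib

open Finset Polynomial Filter

noncomputable section

/-- The Weierstrass correction `W_i(x) = f(x_i)/(C₀ ∏_{j≠i}(x_i − x_j))`. -/
def Wc {n : ℕ} {K : Type*} [NormedField K] (f : Polynomial K) (x : Fin n → K) (i : Fin n) : K :=
  eval (x i) f / (f.leadingCoeff * ∏ j ∈ univ.erase i, (x i - x j))

/-- `dmin x i = min_{j ≠ i} ‖x i - x j‖`. -/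
def dmin {n : ℕ} {K : Type*} [NormedField K] (x : Fin n → K) (i : Fin n) : ℝ :=
  if h : (univ.erase i).Nonempty then (univ.erase i).inf' h fun j => ‖x i - x j‖ else 0

/-- `E_f(x)` : the ℓ^p norm of the vector `(‖W_i(x)‖ / d_i(x))_i`. -/
def Ef {n : ℕ} {K : Type*} [NormedField K] (p : ENNReal) (f : Polynomial K)
    (x : Fin n → K) : ℝ :=
  ‖(WithLp.equiv p (Fin n → ℝ)).symm (fun i => ‖Wc f x i‖ / dmin x i)‖

/-- `σ_i(x) = Σ_{j≠i} W_j(x)/(x_i − x_j)`. -/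
def sigmaf {n : ℕ} {K : Type*} [NormedField K] (f : Polynomial K) (x : Fin n → K)
    (i : Fin n) : K :=
  ∑ j ∈ univ.erase i, Wc f x j / (x i - x j)

/-- The Ehrlich iteration function. -/
def PhiE {n : ℕ} {K : Type*} [NormedField K] (f : Polynomial K) (x : Fin n → K) : Fin n → K :=
  fun i => x i - Wc f x i / (1 + sigmaf f x i)

/-- The Prešić–Tanabe iteration function. -/
def TnbE {n : ℕ} {K : Type*} [NormedField K] (f : Polynomial K) (x : Fin n → K) : Fin n → K :=
  fun i => x i - Wc f x i * (1 - sigmaf f x i)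

/-- `ξ` is a root vector of `f`, i.e. `f(z) = C₀ ∏ (z − ξᵢ)`. -/
def IsRootVector {n : ℕ} {K : Type*} [NormedField K] (f : Polynomial K) (ξ : Fin n → K) : Prop :=
  f = C f.leadingCoeff * ∏ i, (X - C (ξ i))

/-- `E_f(x)` in the case `p = ∞`: the max of `‖W_i(x)‖ / d_i(x)`. -/
def Einf {n : ℕ} {K : Type*} [NormedField K] (f : Polynomial K) (x : Fin n → K) : ℝ :=
  if h : (univ : Finset (Fin n)).Nonempty then univ.sup' h fun i => ‖Wc f x i‖ / dmin x i else 0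

/-- The minimal distance `dmin x i` is at most the distance from `x i` to any other component. -/
theorem dmin_le {n : ℕ} {K : Type*} [NormedField K] (x : Fin n → K) {i j : Fin n} (hij : i ≠ j) :
    dmin x i ≤ ‖x i - x j‖ := by
  have hmem : j ∈ univ.erase i := mem_erase.2 ⟨hij.symm, mem_univ j⟩
  rw [dmin, dif_pos ⟨j, hmem⟩]
  exact inf'_le _ hmem

theorem dmin_nonneg {n : ℕ} {K : Type*} [NormedField K] (x : Fin n → K) (i : Fin n) :
    0 ≤ dmin x i := by
  rw [dmin]
  split_ifs with h
  · exact le_inf' _ _ fun j _ => norm_nonneg _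
  · exact le_rfl

theorem dmin_pos {n : ℕ} {K : Type*} [NormedField K] {x : Fin n → K}
    (hx : Function.Injective x) {i j : Fin n} (hij : i ≠ j) : 0 < dmin x i := by
  rw [dmin, dif_pos ⟨j, mem_erase.2 ⟨hij.symm, mem_univ j⟩⟩]
  refine (lt_inf'_iff _).2 fun k hk => ?_
  exact norm_pos_iff.2 (sub_ne_zero.2 (hx.ne (ne_of_mem_erase hk).symm))

/-- Hölder's inequality against the indicator of `s`: the sum of a nonnegative vector over `s`
is at most `#s ^ (1/q)` times its `ℓ^p` norm. -/
theorem sum_le_card_rpow_mul_lp_norm {ι : Type*} [Fintype ι] {p q : ENNReal} (hp : 1 ≤ p)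
    (hpq : p⁻¹ + q⁻¹ = 1) (s : Finset ι) {u : ι → ℝ} (hu : ∀ i, 0 ≤ u i) :
    ∑ i ∈ s, u i ≤ (#s : ℝ) ^ q⁻¹.toReal * ‖(WithLp.equiv p (ι → ℝ)).symm u‖ := by
  rcases eq_or_ne p ⊤ with rfl | hp_top
  · have hq : q⁻¹ = 1 := by simpa using hpq
    have hle : ∀ i ∈ s, u i ≤ ‖(WithLp.equiv ⊤ (ι → ℝ)).symm u‖ := fun i _ =>
      (le_abs_self _).trans (PiLp.norm_apply_le ((WithLp.equiv ⊤ (ι → ℝ)).symm u) i)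
    simpa [hq] using sum_le_card_nsmul s u _ hle
  · have hr : 1 ≤ p.toReal := by
      simpa using ENNReal.toReal_mono hp_top hp
    have hr0 : 0 < p.toReal := by linarith
    have hp0 : p ≠ 0 := (zero_lt_one.trans_le hp).ne'
    have hq : q⁻¹.toReal = (p.toReal - 1) * (1 / p.toReal) := by
      have hq_top : q⁻¹ ≠ ⊤ := fun h => by simp [h] at hpq
      have h := congrArg ENNReal.toReal hpq
      rw [ENNReal.toReal_add (ENNReal.inv_ne_top.2 hp0) hq_top, ENNReal.toReal_inv,
        ENNReal.toReal_one] at h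
      field_simp at h ⊢
      linarith
    have hsum : 0 ≤ ∑ i ∈ s, u i := sum_nonneg fun i _ => hu i
    have hpow : (∑ i ∈ s, u i) ^ p.toReal ≤
        (#s : ℝ) ^ (p.toReal - 1) * ∑ i, u i ^ p.toReal := by
      refine (Real.rpow_sum_le_const_mul_sum_rpow_of_nonneg s hr fun i _ => hu i).trans ?_
      gcongr
      · exact fun i _ _ => Real.rpow_nonneg (hu i) _
      · exact subset_univ s
    have hnorm : ‖(WithLp.equiv p (ι → ℝ)).symm u‖ =
        (∑ i, u i ^ p.toReal) ^ (1 / p.toReal) := by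
      rw [PiLp.norm_eq_sum hr0]
      simp [abs_of_nonneg (hu _)]
    calc ∑ i ∈ s, u i = ((∑ i ∈ s, u i) ^ p.toReal) ^ (1 / p.toReal) := by
          rw [← Real.rpow_mul hsum, mul_one_div_cancel hr0.ne', Real.rpow_one]
      _ ≤ ((#s : ℝ) ^ (p.toReal - 1) * ∑ i, u i ^ p.toReal) ^ (1 / p.toReal) := by
          gcongr
      _ = (#s : ℝ) ^ q⁻¹.toReal * ‖(WithLp.equiv p (ι → ℝ)).symm u‖ := by
          rw [hnorm, hq, Real.rpow_mul (Nat.cast_nonneg _), Real.mul_rpow (by positivity)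
            (sum_nonneg fun i _ => Real.rpow_nonneg (hu i) _)]

/-- `σ_i(x)` is bounded by `(n - 1) ^ (1/q) * E_f(x)`. -/
theorem norm_sigmaf_le {n : ℕ} {K : Type*} [NormedField K] (f : Polynomial K) {p q : ENNReal}
    (hp : 1 ≤ p) (hpq : p⁻¹ + q⁻¹ = 1) {x : Fin n → K} (hx : Function.Injective x) (i : Fin n) :
    ‖sigmaf f x i‖ ≤ ((n : ℝ) - 1) ^ q⁻¹.toReal * Ef p f x := by
  have hcard : (#(univ.erase i) : ℝ) = (n : ℝ) - 1 := by
    rw [card_erase_of_mem (mem_univ i), card_univ, Fintype.card_fin,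
      Nat.cast_sub (Nat.one_le_of_lt i.isLt), Nat.cast_one]
  calc ‖sigmaf f x i‖ ≤ ∑ j ∈ univ.erase i, ‖Wc f x j‖ / dmin x j := by
        refine norm_sum_le_of_le _ fun j hj => ?_
        have hji : j ≠ i := ne_of_mem_erase hj
        rw [norm_div, norm_sub_rev]
        exact div_le_div_of_nonneg_left (norm_nonneg _) (dmin_pos hx hji) (dmin_le x hji)
    _ ≤ ((n : ℝ) - 1) ^ q⁻¹.toReal * Ef p f x := by
        rw [← hcard]
        exact sum_le_card_rpow_mul_lp_norm hp hpq _ fun j =>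
          div_nonneg (norm_nonneg _) (dmin_nonneg x j)

/-- Proinov, Lemma 4.2. -/
theorem stmt_15 {n : ℕ} {K : Type*} [NormedField K] [CompleteSpace K] (hn : 2 ≤ n)
    (f : Polynomial K) (hdeg : f.degree = (n : ℕ))
    (p q : ENNReal) (hp : 1 ≤ p) (hpq : p⁻¹ + q⁻¹ = 1)
    (a : ℝ) (ha : a = ((n : ℝ) - 1) ^ (ENNReal.toReal q⁻¹)) :
    ∀ x : Fin n → K, Function.Injective x →
      ∀ i : Fin n, ‖x i - TnbE f x i‖ ≤ (1 + a * Ef p f x) * ‖Wc f x i‖ := by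
  intro x hx i
  have hσ : ‖1 - sigmaf f x i‖ ≤ 1 + a * Ef p f x := by
    refine (norm_sub_le _ _).trans ?_
    rw [norm_one, ha]
    gcongr
    exact norm_sigmaf_le f hp hpq hx i
  rw [TnbE, sub_sub_cancel, norm_mul, mul_comm]
  gcongr
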